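/- arXiv:1505.05697 — 5 statements merged into one kernel-verified Lean document; each statement's English description precedes it below -/
import Mathlib

section
/- Let G be a simple graph on vertex set V, let t ≥ 1 be a natural number, and let C₁, C₂, …, C_t be nonempty subsets of V such that: (i) for every i and all a, b ∈ C_i, a and b are reachable from each other in G and dist_G(a,b) ≤ 2; (ii) for every 1 ≤ i < t there exist u ∈ C_i and v ∈ C_{i+1} with u adjacent to v in G. Then for every x ∈ C₁ and y ∈ C_t, x and y are reachable from each other in G and dist_G(x,y) ≤ 3t − 1. -/
/-- Along a chain of clusters of diameter at most 2, any vertex of the `k`-th cluster (counting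
from zero) is joined to any vertex of the first one by a walk of length at most `3 * k + 2`. -/
theorem SimpleGraph.exists_walk_length_le_of_cluster_chain {V : Type*} (G : SimpleGraph V) {t : ℕ}
    (C : Fin t → Set V)
    (hdiam : ∀ (i : Fin t), ∀ a ∈ C i, ∀ b ∈ C i, G.Reachable a b ∧ G.dist a b ≤ 2)
    (hchain : ∀ (i : Fin t) (h : (i : ℕ) + 1 < t),
      ∃ u ∈ C i, ∃ v ∈ C ⟨(i : ℕ) + 1, h⟩, G.Adj u v)
    (ht : 0 < t) {x : V} (hx : x ∈ C ⟨0, ht⟩) (k : ℕ) (hk : k < t) (y : V) (hy : y ∈ C ⟨k, hk⟩) :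
    ∃ p : G.Walk x y, p.length ≤ 3 * k + 2 := by
  induction k generalizing y with
  | zero =>
    obtain ⟨hr, hd⟩ := hdiam _ x hx y hy
    obtain ⟨p, hp⟩ := hr.exists_walk_length_eq_dist
    exact ⟨p, by omega⟩
  | succ k ih =>
    obtain ⟨u, hu, v, hv, huv⟩ := hchain ⟨k, by omega⟩ hk
    obtain ⟨p, hp⟩ := ih (by omega) u hu
    obtain ⟨hr, hd⟩ := hdiam _ v hv y hy
    obtain ⟨q, hq⟩ := hr.exists_walk_length_eq_dist
    refine ⟨p.append (.cons huv q), ?_⟩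
    rw [SimpleGraph.Walk.length_append, SimpleGraph.Walk.length_cons]
    omega

/-- A chain of `t` clusters, each of diameter at most 2, consecutive clusters joined by
an edge: any `x` in the first and `y` in the last cluster are reachable with
`dist(x,y) ≤ 3t − 1`. -/
theorem stmt_2 {V : Type*} (G : SimpleGraph V) (t : ℕ) (ht : 1 ≤ t)
    (C : Fin t → Set V) (hne : ∀ i, (C i).Nonempty)
    (hdiam : ∀ (i : Fin t), ∀ a ∈ C i, ∀ b ∈ C i, G.Reachable a b ∧ G.dist a b ≤ 2)
    (hchain : ∀ (i : Fin t) (h : (i : ℕ) + 1 < t),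
      ∃ u ∈ C i, ∃ v ∈ C ⟨(i : ℕ) + 1, h⟩, G.Adj u v)
    (x y : V) (hx : x ∈ C ⟨0, by omega⟩) (hy : y ∈ C ⟨t - 1, by omega⟩) :
    G.Reachable x y ∧ G.dist x y ≤ 3 * t - 1 := by
  obtain ⟨p, hp⟩ :=
    G.exists_walk_length_le_of_cluster_chain C hdiam hchain (by omega) hx (t - 1) (by omega) y hy
  have hd := G.dist_le p
  exact ⟨p.reachable, by omega⟩
end

section
/- Let G be a connected finite simple graph on a linearly ordered vertex set V, and let D ⊆ V be a nonempty set. For each vertex u, define ruler(u) to be the element v ∈ D minimizing the pair (dist_G(v,u), v) in lexicographic order (smallest distance, ties broken by the linear order). Then: (i) for every vertex u with v = ruler(u), and every vertex x satisfying dist_G(v,x) + dist_G(x,u) = dist_G(v,u) (i.e., x lies on a shortest path from v to u), we have ruler(x) = v; (ii) consequently, for every u with ruler(u) = v there is a walk from v to u of length dist_G(v,u) all of whose vertices x satisfy ruler(x) = v, so the subgraph induced on the cluster C_v = {u : ruler(u) = v} is connected and every u ∈ C_v is at distance at most dist_G(v,u) from v inside C_v. -/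
namespace SimpleGraph

variable {V : Type*} {G : SimpleGraph V}

/-- Every vertex of a shortest walk splits the distance between the endpoints. -/
theorem Walk.dist_add_dist_of_mem_support_of_length_eq_dist {u v x : V} (hconn : G.Connected)
    {p : G.Walk u v} (hp : p.length = G.dist u v) (hx : x ∈ p.support) :
    G.dist u x + G.dist x v = G.dist u v := by
  classical
  have hlen : (p.takeUntil x hx).length + (p.dropUntil x hx).length = p.length := by
    rw [← Walk.length_append, Walk.take_spec]
  have h₁ := dist_le (p.takeUntil x hx)
  have h₂ := dist_le (p.dropUntil x hx)
  have h₃ := hconn.dist_triangle (u := u) (v := x) (w := v)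
  omega

/-- A walk with support in `s` bounds the distance in the subgraph induced on `s`. -/
theorem Walk.dist_induce_le_length {u v : V} {s : Set V} (p : G.Walk u v)
    (hs : ∀ x ∈ p.support, x ∈ s) :
    (G.induce s).dist ⟨u, hs u p.start_mem_support⟩ ⟨v, hs v p.end_mem_support⟩ ≤ p.length := by
  have hlen : (p.induce s hs).length = p.length := by
    conv_rhs => rw [← p.map_induce hs]
    exact (Walk.length_map _ _).symm
  exact hlen ▸ dist_le (p.induce s hs)

end SimpleGraph


/-- Voronoi clusters with consistent tie-breaking: if `ruler u` is the element of `D`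
minimizing `(dist, id)` lexicographically, then (i) every vertex on a shortest path from
`ruler u` to `u` has the same ruler; (ii) there is a shortest walk from `ruler u` to `u`
staying inside the cluster of `u`; hence each cluster is connected in the induced
subgraph, with distances inside the cluster bounded by the distance to the ruler. -/
theorem stmt_4 {V : Type*} [Fintype V] [LinearOrder V] (G : SimpleGraph V)
    (hconn : G.Connected) (D : Set V) (hD : D.Nonempty) (ruler : V → V)
    (hmem : ∀ u, ruler u ∈ D)
    (hmin : ∀ u, ∀ v ∈ D, G.dist (ruler u) u < G.dist v u ∨
      (G.dist (ruler u) u = G.dist v u ∧ ruler u ≤ v)) :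
    (∀ u x, G.dist (ruler u) x + G.dist x u = G.dist (ruler u) u → ruler x = ruler u)
    ∧ (∀ u, ∃ p : G.Walk (ruler u) u, p.length = G.dist (ruler u) u ∧
        ∀ x ∈ p.support, ruler x = ruler u)
    ∧ (∀ u₁ u₂ (h : ruler u₁ = ruler u₂),
        (G.induce {x | ruler x = ruler u₁}).Reachable ⟨u₁, rfl⟩ ⟨u₂, h.symm⟩)
    ∧ (∀ u, ∃ hv : ruler (ruler u) = ruler u,
        (G.induce {x | ruler x = ruler u}).dist ⟨ruler u, hv⟩ ⟨u, rfl⟩ ≤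
          G.dist (ruler u) u) := by
  have hruler : ∀ u x, G.dist (ruler u) x + G.dist x u = G.dist (ruler u) u →
      ruler x = ruler u := by
    intro u x hx
    have htri := hconn.dist_triangle (u := ruler x) (v := x) (w := u)
    rcases hmin u (ruler x) (hmem x) with h₁ | ⟨h₁, hle₁⟩ <;>
      rcases hmin x (ruler u) (hmem u) with h₂ | ⟨h₂, hle₂⟩
    · omega
    · omega
    · omega
    · exact le_antisymm hle₂ hle₁
  have hwalk : ∀ u, ∃ p : G.Walk (ruler u) u, p.length = G.dist (ruler u) u ∧
      ∀ x ∈ p.support, ruler x = ruler u := by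
    intro u
    obtain ⟨p, hp⟩ := hconn.exists_walk_length_eq_dist (ruler u) u
    exact ⟨p, hp, fun x hx => hruler u x
      (SimpleGraph.Walk.dist_add_dist_of_mem_support_of_length_eq_dist hconn hp hx)⟩
  refine ⟨hruler, hwalk, fun u₁ u₂ h => ?_, fun u => ?_⟩
  · obtain ⟨p, -, hp⟩ := hwalk u₁
    obtain ⟨q, -, hq⟩ := hwalk u₂
    let r := p.reverse.append (q.copy h.symm rfl)
    have hr : ∀ x ∈ r.support, x ∈ {x | ruler x = ruler u₁} := by
      intro x hx
      rcases (SimpleGraph.Walk.mem_support_append_iff _ _).mp hx with hx | hx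
      · exact hp x (by simpa using hx)
      · exact (hq x (by simpa using hx)).trans h.symm
    exact ⟨r.induce _ hr⟩
  · obtain ⟨p, hlen, hp⟩ := hwalk u
    exact ⟨hp _ p.start_mem_support, hlen ▸ p.dist_induce_le_length hp⟩
end

section
/- Let A be a natural number, let V be a finite vertex set, G a simple graph on V, ι an index type, and β a finite set. Let X : ι → Finset β be a family of sets which is A-union-free: for every index c₀ and every finite set T of indices with |T| ≤ A and c₀ ∉ T, X(c₀) is not contained in the union ⋃_{c ∈ T} X(c). Let Π : V → Finset V satisfy: Π(v) is a subset of the neighbors of v, |Π(v)| ≤ A for all v, and for every edge {u,v} of G, u ∈ Π(v) or v ∈ Π(u). Let φ : V → ι be a proper coloring of G (adjacent vertices receive distinct indices). Then: (i) for every vertex v, the set X(φ(v)) \ ⋃_{u ∈ Π(v)} X(φ(u)) is nonempty; (ii) any function φ' : V → β with φ'(v) ∈ X(φ(v)) \ ⋃_{u ∈ Π(v)} X(φ(u)) for every v is a proper coloring of G (adjacent vertices receive distinct values of φ'). -/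
/-- The recoloring step of the Arb-Linial / Linial coloring procedure via an
`A`-union-free family: (i) each vertex can pick a fresh color in
`X(φ v) \ ⋃_{u ∈ P v} X(φ u)`; (ii) any such choice is again a proper coloring. -/
theorem stmt_5 {V ι β : Type*} [DecidableEq ι] [DecidableEq β] [Fintype β]
    (A : ℕ) (G : SimpleGraph V) (X : ι → Finset β)
    (hUF : ∀ (c₀ : ι) (T : Finset ι), T.card ≤ A → c₀ ∉ T → ¬ X c₀ ⊆ T.biUnion X)
    (P : V → Finset V)
    (hPsub : ∀ v : V, ∀ u ∈ P v, G.Adj v u)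
    (hPcard : ∀ v : V, (P v).card ≤ A)
    (hPcover : ∀ u v : V, G.Adj u v → u ∈ P v ∨ v ∈ P u)
    (φ : V → ι) (hφ : ∀ u v : V, G.Adj u v → φ u ≠ φ v) :
    (∀ v : V, (X (φ v) \ (P v).biUnion fun u => X (φ u)).Nonempty) ∧
    (∀ φ' : V → β,
      (∀ v : V, φ' v ∈ X (φ v) \ (P v).biUnion fun u => X (φ u)) →
      ∀ u v : V, G.Adj u v → φ' u ≠ φ' v) := by
  refine ⟨fun v => ?_, fun φ' hφ' u v huv heq => ?_⟩
  · rw [Finset.sdiff_nonempty, ← Finset.image_biUnion]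
    refine hUF (φ v) ((P v).image φ) (Finset.card_image_le.trans (hPcard v)) fun hmem => ?_
    obtain ⟨u, hu, huv⟩ := Finset.mem_image.mp hmem
    exact hφ v u (hPsub v u hu) huv.symm
  · have hu := Finset.mem_sdiff.mp (hφ' u)
    have hv := Finset.mem_sdiff.mp (hφ' v)
    rcases hPcover u v huv with h | h
    · exact hv.2 (Finset.mem_biUnion.mpr ⟨u, h, heq ▸ hu.1⟩)
    · exact hu.2 (Finset.mem_biUnion.mpr ⟨v, h, heq ▸ hv.1⟩)
end

section
/- Let G be a finite simple graph on vertex set V. Let Q be a finite collection of pairwise disjoint nonempty subsets of V (clusters) whose union is V, and let label : Q → Fin ℓ be a labeling such that for any two distinct clusters C, C' ∈ Q with label(C) = label(C'), every u ∈ C and v ∈ C' satisfy u ≠ v and, if u and v are reachable from each other, dist_G(u,v) ≥ 3. For each cluster C ∈ Q let D_C ⊆ Γ⁺(C) be a set that dominates C and has minimum cardinality among all subsets of Γ⁺(C) that dominate C. Then for every dominating set W of G, |⋃_{C ∈ Q} D_C| ≤ ℓ · |W|. -/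
/-- The closed neighborhood `Γ⁺(S)` of a set `S`: `S` together with all vertices
adjacent to a member of `S`. -/
def closedNbhd {V : Type*} (G : SimpleGraph V) (S : Set V) : Set V :=
  S ∪ {x | ∃ s ∈ S, G.Adj s x}

/-- `D` dominates `C`: every vertex of `C` is in `D` or has a neighbor in `D`. -/
def dominates {V : Type*} (G : SimpleGraph V) (D C : Set V) : Prop :=
  ∀ v ∈ C, v ∈ D ∨ ∃ d ∈ D, G.Adj d v

theorem exists_walk_length_le_one_of_mem_closedNbhd {V : Type*} {G : SimpleGraph V} {S : Set V}
    {x : V} (hx : x ∈ closedNbhd G S) : ∃ s ∈ S, ∃ p : G.Walk s x, p.length ≤ 1 := by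
  rcases hx with hx | ⟨s, hs, hadj⟩
  · exact ⟨x, hx, .nil, by simp⟩
  · exact ⟨s, hs, hadj.toWalk, by simp⟩

theorem disjoint_closedNbhd_of_three_le_dist {V : Type*} {G : SimpleGraph V} {S T : Set V}
    (h : ∀ u ∈ S, ∀ v ∈ T, G.Reachable u v → 3 ≤ G.dist u v) :
    Disjoint (closedNbhd G S) (closedNbhd G T) := by
  rw [Set.disjoint_left]
  intro x hxS hxT
  obtain ⟨u, hu, p, hp⟩ := exists_walk_length_le_one_of_mem_closedNbhd hxS
  obtain ⟨v, hv, q, hq⟩ := exists_walk_length_le_one_of_mem_closedNbhd hxT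
  have hfar := h u hu v hv ⟨p.append q.reverse⟩
  have hnear := SimpleGraph.dist_le (p.append q.reverse)
  rw [SimpleGraph.Walk.length_append, SimpleGraph.Walk.length_reverse] at hnear
  omega

theorem dominates.inter_closedNbhd {V : Type*} {G : SimpleGraph V} {W C : Set V}
    (hW : dominates G W C) : dominates G (W ∩ closedNbhd G C) C := by
  intro v hv
  rcases hW v hv with h | ⟨d, hd, hadj⟩
  · exact .inl ⟨h, .inl hv⟩
  · exact .inr ⟨d, ⟨hd, .inr ⟨v, hv, hadj.symm⟩⟩, hadj⟩

theorem dominates.mono_right {V : Type*} {G : SimpleGraph V} {W C C' : Set V}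
    (hW : dominates G W C) (h : C' ⊆ C) : dominates G W C' :=
  fun v hv => hW v (h hv)

theorem sum_ncard_inter_le_of_pairwiseDisjoint {ι V : Type*} [Finite V] (s : Finset ι)
    (f : ι → Set V) (hf : (s : Set ι).PairwiseDisjoint f) (W : Set V) :
    ∑ i ∈ s, (W ∩ f i).ncard ≤ W.ncard := by
  have hd : (s : Set ι).PairwiseDisjoint fun i => W ∩ f i :=
    hf.mono fun _ => Set.inter_subset_right
  rw [← finsum_mem_coe_finset,
    ← s.finite_toSet.ncard_biUnion (fun _ _ => Set.toFinite _) hd]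
  exact Set.ncard_le_ncard (Set.iUnion₂_subset fun _ _ => Set.inter_subset_left) (Set.toFinite _)

/-- Lemma 6.14: given a 3-separated network decomposition with `ℓ` labels and, for each
cluster `C`, a minimum dominating set `D_C ⊆ Γ⁺(C)` of `C`, the union of the `D_C` is at
most `ℓ` times the size of any dominating set of `G`. -/
theorem stmt_9 {V : Type*} [Fintype V] (G : SimpleGraph V)
    (Q : Finset (Set V)) (hne : ∀ C ∈ Q, C.Nonempty)
    (hdisj : ∀ C ∈ Q, ∀ C' ∈ Q, C ≠ C' → Disjoint C C')
    (hcover : ∀ v : V, ∃ C ∈ Q, v ∈ C)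
    (ℓ : ℕ) (label : Set V → Fin ℓ)
    (hsep : ∀ C ∈ Q, ∀ C' ∈ Q, C ≠ C' → label C = label C' →
      ∀ u ∈ C, ∀ v ∈ C', u ≠ v ∧ (G.Reachable u v → 3 ≤ G.dist u v))
    (D : Set V → Set V)
    (hDsub : ∀ C ∈ Q, D C ⊆ closedNbhd G C)
    (hDdom : ∀ C ∈ Q, dominates G (D C) C)
    (hDmin : ∀ C ∈ Q, ∀ D' ⊆ closedNbhd G C, dominates G D' C → (D C).ncard ≤ D'.ncard)
    (W : Set V) (hW : dominates G W Set.univ) :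
    (⋃ C ∈ Q, D C).ncard ≤ ℓ * W.ncard := by
  calc (⋃ C ∈ Q, D C).ncard
      ≤ ∑ C ∈ Q, (D C).ncard := Finset.set_ncard_biUnion_le Q D
    _ ≤ ∑ C ∈ Q, (W ∩ closedNbhd G C).ncard :=
        Finset.sum_le_sum fun C hC => hDmin C hC _ Set.inter_subset_right
          (hW.mono_right C.subset_univ).inter_closedNbhd
    _ = ∑ i : Fin ℓ, ∑ C ∈ Q with label C = i, (W ∩ closedNbhd G C).ncard :=
        (Finset.sum_fiberwise Q label _).symm
    _ ≤ ∑ _i : Fin ℓ, W.ncard := by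
        refine Finset.sum_le_sum fun i _ => sum_ncard_inter_le_of_pairwiseDisjoint _ _ ?_ W
        intro C hC C' hC' hCC'
        simp only [Finset.coe_filter, Set.mem_ofPred_eq] at hC hC'
        exact disjoint_closedNbhd_of_three_le_dist fun u hu v hv =>
          (hsep C hC.1 C' hC'.1 hCC' (hC.2.trans hC'.2.symm) u hu v hv).2
    _ = ℓ * W.ncard := by simp
end

section
/- Let G be a finite simple graph on vertex set V, t ≥ 1 a natural number, and C₁, …, C_h ⊆ V subsets. Let Ĉ = ⋃_{i=1}^{h} B_{t−1}(C_i), where B_r(S) = {x : ∃ s ∈ S, x is reachable from s and dist_G(x,s) ≤ r}. Call a set H of edges of G 'good' if every edge of H has both endpoints in Ĉ and for every edge {u,v} of G with u and v both belonging to a common C_i there is a walk from u to v of length at most t using only edges of H. Suppose H* is a set of edges of G such that every edge {u,v} of G admits a walk from u to v of length at most t using only edges of H* (a t-spanner of G). Then the set {e ∈ H* : both endpoints of e lie in Ĉ} is good, and consequently every good set ℋ of minimum cardinality satisfies |ℋ| ≤ |H*|. -/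
/-- The ball of radius `r` around a set `S`. -/
def sgBall {V : Type*} (G : SimpleGraph V) (r : ℕ) (S : Set V) : Set V :=
  {x | ∃ s ∈ S, G.Reachable s x ∧ G.dist x s ≤ r}

/-- A set `H` of edges of `G` is good (for clusters `C` and enlarged region `Chat`) if
its edges lie inside `Chat` and every intra-cluster edge of `G` is spanned by a walk of
length at most `t` using only edges of `H`. -/
def sgGood {V : Type*} (G : SimpleGraph V) (t : ℕ) {h : ℕ} (C : Fin h → Set V)
    (Chat : Set V) (H : Set (Sym2 V)) : Prop :=
  H ⊆ G.edgeSet ∧ (∀ e ∈ H, ∀ x ∈ e, x ∈ Chat) ∧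
  ∀ u v : V, G.Adj u v → (∃ i, u ∈ C i ∧ v ∈ C i) →
    ∃ p : G.Walk u v, p.length ≤ t ∧ ∀ e ∈ p.edges, e ∈ H

theorem subset_sgBall {V : Type*} (G : SimpleGraph V) (r : ℕ) (S : Set V) :
    S ⊆ sgBall G r S :=
  fun x hx => ⟨x, hx, SimpleGraph.Reachable.refl x, by simp⟩

/-- A walk of length at most `t` with both endpoints in `S` stays in the `(t - 1)`-ball
around `S`. -/
theorem SimpleGraph.Walk.mem_sgBall_of_mem_support {V : Type*} {G : SimpleGraph V} {t : ℕ}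
    {S : Set V} {u v x : V} (p : G.Walk u v) (hp : p.length ≤ t) (hu : u ∈ S) (hv : v ∈ S)
    (hx : x ∈ p.support) : x ∈ sgBall G (t - 1) S := by
  classical
  by_cases hxv : x = v
  · exact subset_sgBall G _ S (hxv ▸ hv)
  · refine ⟨u, hu, (p.takeUntil x hx).reachable, ?_⟩
    have hdist := SimpleGraph.dist_le (p.takeUntil x hx)
    have hlen := congrArg SimpleGraph.Walk.length (p.take_spec hx)
    rw [SimpleGraph.Walk.length_append] at hlen
    have hpos : (p.dropUntil x hx).length ≠ 0 :=
      fun h0 => hxv (SimpleGraph.Walk.eq_of_length_eq_zero h0)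
    rw [SimpleGraph.dist_comm]
    omega

/-- Lemma 6.15: the restriction of a `t`-spanner `H*` of `G` to the union `Ĉ` of the
`(t−1)`-balls around the clusters is good; hence any minimum-cardinality good set has at
most `|H*|` edges. -/
theorem stmt_11 {V : Type*} [Fintype V] (G : SimpleGraph V) (t : ℕ) (ht : 1 ≤ t)
    (h : ℕ) (C : Fin h → Set V)
    (Hstar : Set (Sym2 V)) (hsub : Hstar ⊆ G.edgeSet)
    (hspan : ∀ u v : V, G.Adj u v →
      ∃ p : G.Walk u v, p.length ≤ t ∧ ∀ e ∈ p.edges, e ∈ Hstar) :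
    sgGood G t C (⋃ i, sgBall G (t - 1) (C i))
      {e ∈ Hstar | ∀ x ∈ e, x ∈ ⋃ i, sgBall G (t - 1) (C i)} ∧
    ∀ ℋ : Set (Sym2 V), sgGood G t C (⋃ i, sgBall G (t - 1) (C i)) ℋ →
      (∀ ℋ', sgGood G t C (⋃ i, sgBall G (t - 1) (C i)) ℋ' → ℋ.ncard ≤ ℋ'.ncard) →
      ℋ.ncard ≤ Hstar.ncard := by
  have hgood : sgGood G t C (⋃ i, sgBall G (t - 1) (C i))
      {e ∈ Hstar | ∀ x ∈ e, x ∈ ⋃ i, sgBall G (t - 1) (C i)} := by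
    refine ⟨fun e he => hsub he.1, fun e he => he.2, ?_⟩
    rintro u v huv ⟨i, hu, hv⟩
    obtain ⟨p, hp, hpH⟩ := hspan u v huv
    exact ⟨p, hp, fun e he => ⟨hpH e he, fun x hx => Set.mem_iUnion.2
      ⟨i, p.mem_sgBall_of_mem_support hp hu hv (p.mem_support_of_mem_edges he hx)⟩⟩⟩
  exact ⟨hgood, fun ℋ _ hmin => (hmin _ hgood).trans
    (Set.ncard_le_ncard (Set.sep_subset _ _) (Set.toFinite _))⟩
end
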